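/- Let P be a finite poset and let ex(P,n) be the maximum size of a family F ⊆ 2^[n] not containing P as a subposet. If the Hasse diagram of P is a tree, then ex(P,n) = (h(P)-1)·C(n,⌊n/2⌋)·(1 + O(1/n)), where h(P) is the height of P. -/

import Mathlib

/-- A finite poset has height `h` if `h` is the maximum number of elements of a chain. -/
def HasHeight (α : Type*) [Preorder α] (h : ℕ) : Prop :=
  (∃ c : Finset α, IsChain (· ≤ ·) (c : Set α) ∧ c.card = h) ∧
    ∀ c : Finset α, IsChain (· ≤ ·) (c : Set α) → c.card ≤ h

/-- `𝓕 ⊆ 2^[n]` is `P`-free if there is no injection `f : P → 𝓕` with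
`a ≤ b → f a ⊆ f b`. -/
def PFree (α : Type*) [Preorder α] {n : ℕ} (𝓕 : Finset (Finset (Fin n))) : Prop :=
  ¬ ∃ f : α → Finset (Fin n), Function.Injective f ∧ (∀ a, f a ∈ 𝓕) ∧
      ∀ a b : α, a ≤ b → f a ⊆ f b

open Finset

/-- A finite chain can be listed in increasing order. -/
theorem IsChain.exists_enumeration {S : Type*} [PartialOrder S] [Nonempty S] (s : Finset S)
    (hs : IsChain (· ≤ ·) (s : Set S)) :
    ∃ g : ℕ → S, (∀ t < #s, g t ∈ s) ∧ ∀ t u, t < u → u < #s → g t < g u := by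
  classical
  induction hn : #s generalizing s with
  | zero => exact ⟨fun _ => Classical.arbitrary S, by simp, by simp⟩
  | succ n ih =>
    have hne : s.Nonempty := card_pos.1 (by omega)
    obtain ⟨m, hm⟩ := s.exists_maximal hne
    have hms : m ∈ s := hm.1
    obtain ⟨g, hg, hlt⟩ := ih (s.erase m) (hs.mono (by simp)) (by
      rw [card_erase_of_mem hms]; omega)
    refine ⟨fun t => if t < n then g t else m, fun t ht => ?_, fun t u htu hu => ?_⟩
    · by_cases h : t < n
      · simpa [h] using mem_of_mem_erase (hg t h)
      · simpa [h] using hms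
    · have ht : t < n := by omega
      by_cases h : u < n
      · simpa [h, ht] using hlt t u htu h
      · have h1 := hg t ht
        have h2 := ne_of_mem_erase h1
        have h3 := mem_of_mem_erase h1
        simp only [ht, h, if_true, if_false]
        rcases hs h3 hms h2 with h4 | h4
        · exact lt_of_le_of_ne h4 h2
        · exact absurd (hm.eq_of_le h3 h4).symm h2

/-- Suppose each `ω : Ω` comes with a chain `V ω` in `F`, where for `A < B` in `F` the chains through
both `A` and `B` are a small fraction of those through `A` and of those through `B`. If the chains
have average length noticeably above `k - 1`, then `F` has `k` nonempty levels such that every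
element of a level lies below (above) at least `p` elements of the next (previous) level. -/
theorem exists_branching_levels {Ω S : Type*} [Fintype Ω] [PartialOrder S] [Nonempty S]
    [DecidableEq S] [DecidableLT S] (F : Finset S) (V : Ω → Finset S) (hVF : ∀ ω, V ω ⊆ F)
    (hV : ∀ ω, IsChain (· ≤ ·) (V ω : Set S)) (k p : ℕ) (δ : ℝ) (hδ : 0 ≤ δ)
    (hsmall : ∀ A ∈ F, ∀ B ∈ F, A < B →
      (#{ω | A ∈ V ω ∧ B ∈ V ω} : ℝ) ≤ δ * #{ω | A ∈ V ω} ∧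
      (#{ω | A ∈ V ω ∧ B ∈ V ω} : ℝ) ≤ δ * #{ω | B ∈ V ω})
    (hbig : ((k : ℝ) - 1) * Fintype.card Ω + k * p * δ * ∑ ω, (#(V ω) : ℝ)
      < ∑ ω, (#(V ω) : ℝ)) :
    ∃ L : ℕ → Finset S, (∀ j < k, L j ⊆ F) ∧ (∀ j < k, (L j).Nonempty) ∧
      ∀ j, j + 1 < k → (∀ A ∈ L j, p ≤ #{B ∈ L (j + 1) | A < B}) ∧
        ∀ B ∈ L (j + 1), p ≤ #{A ∈ L j | A < B} := by
  classical
  choose g hgV hglt using fun ω => (hV ω).exists_enumeration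
  have hginj : ∀ ω t u, t < #(V ω) → u < #(V ω) → g ω t = g ω u → t = u := by
    intro ω t u ht hu h
    rcases lt_trichotomy t u with h1 | h1 | h1
    · exact absurd h (hglt ω t u h1 hu).ne
    · exact h1
    · exact absurd h (hglt ω u t h1 ht).ne'
  set N : S → ℝ := fun A => #{ω | A ∈ V ω} with hN
  set M₀ : Finset (Σ _ : Ω, ℕ) := univ.sigma fun ω => range (#(V ω) + 1 - k) with hM₀
  set M : Finset (ℕ × S) → Finset (Σ _ : Ω, ℕ) := fun D =>
    M₀.filter fun x => ∀ j < k, (j, g x.1 (x.2 + j)) ∉ D with hM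
  set cost : Finset (ℕ × S) → ℝ := fun D => ∑ x ∈ D, p * δ * N x.2 with hcost
  have hsumN : ∑ A ∈ F, N A = ∑ ω, (#(V ω) : ℝ) := by
    have := sum_card_bipartiteAbove_eq_sum_card_bipartiteBelow (s := F) (t := (univ : Finset Ω))
      (fun A ω => A ∈ V ω)
    simp only [bipartiteAbove, bipartiteBelow] at this
    have h2 : ∀ ω, F.filter (fun A => A ∈ V ω) = V ω := by
      intro ω; ext A; simpa using fun h => hVF ω h
    simp only [h2] at this
    simp only [hN]
    exact_mod_cast this
  have hM₀card : ∑ ω, (#(V ω) : ℝ) - (k - 1) * Fintype.card Ω ≤ #M₀ := by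
    rw [hM₀, card_sigma]
    simp only [card_range]
    push_cast
    have : ∑ ω : Ω, ((#(V ω) : ℝ) - (k - 1)) ≤ ∑ ω : Ω, ((#(V ω) + 1 - k : ℕ) : ℝ) := by
      apply sum_le_sum
      intro ω _
      have : #(V ω) + 1 ≤ (#(V ω) + 1 - k) + k := by omega
      have : ((#(V ω) + 1 : ℕ) : ℝ) ≤ ((#(V ω) + 1 - k) + k : ℕ) := by exact_mod_cast this
      push_cast at this
      linarith
    rw [sum_sub_distrib] at this
    simp at this
    linarith
  set cand := (range k ×ˢ F).powerset.filter fun D => (#M₀ : ℝ) ≤ #(M D) + cost D with hcand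
  have hcand0 : (∅ : Finset (ℕ × S)) ∈ cand := by
    simp [hcand, hM, hcost]
  obtain ⟨D, hD⟩ := cand.exists_maximal ⟨_, hcand0⟩
  have hDmem := hD.1
  simp only [hcand, mem_filter, mem_powerset] at hDmem
  obtain ⟨hDsub, hDle⟩ := hDmem
  have hNnn : ∀ A, 0 ≤ N A := fun A => by simp [hN]
  have hMne : (M D).Nonempty := by
    have h1 : cost D ≤ k * p * δ * ∑ ω, (#(V ω) : ℝ) := by
      calc cost D ≤ ∑ x ∈ range k ×ˢ F, p * δ * N x.2 := by
            apply sum_le_sum_of_subset_of_nonneg hDsub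
            intro i _ _
            have := hNnn i.2
            positivity
        _ = _ := by
            rw [sum_product]
            simp only [← mul_sum]
            rw [hsumN]
            simp
            ring
    have : (0 : ℝ) < #(M D) := by linarith
    exact card_pos.1 (by exact_mod_cast this)
  have hMD : ∀ x ∈ M D, ∀ j < k, x.2 + j < #(V x.1) := by
    intro x hx j hj
    simp only [hM, hM₀, mem_filter, mem_sigma, mem_univ, mem_range, true_and] at hx
    omega
  -- an element with fewer than `p` continuations would contradict the maximality of `D`
  have key : ∀ j < k, ∀ A, (∃ x ∈ M D, g x.1 (x.2 + j) = A) → ∀ T : Finset S,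
      (∀ B ∈ T, (#{ω | A ∈ V ω ∧ B ∈ V ω} : ℝ) ≤ δ * N A) →
      (∀ x ∈ M D, g x.1 (x.2 + j) = A → ∃ B ∈ T, B ∈ V x.1) → p ≤ #T := by
    intro j hj A ⟨x, hx, hxA⟩ T hT hcov
    by_contra! hlt
    have hAF : A ∈ F := hxA ▸ hVF _ (hgV _ _ (hMD x hx j hj))
    have hnot : (j, A) ∉ D := by
      have := (mem_filter.1 hx).2 j hj
      rwa [hxA] at this
    have hins : insert (j, A) D ∈ cand := by
      simp only [hcand, mem_filter, mem_powerset]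
      refine ⟨insert_subset (by simp [hj, hAF]) hDsub, ?_⟩
      have hcostI : cost (insert (j, A) D) = p * δ * N A + cost D := by
        simp only [hcost]; rw [sum_insert hnot]
      set R := (M D).filter fun x => g x.1 (x.2 + j) = A with hR
      have hsub : M D ⊆ M (insert (j, A) D) ∪ R := by
        intro y hy
        by_cases h : g y.1 (y.2 + j) = A
        · exact mem_union_right _ (by simp [hR, hy, h])
        · apply mem_union_left
          simp only [hM, mem_filter] at hy ⊢
          refine ⟨hy.1, fun i hi => ?_⟩
          simp only [mem_insert, Prod.mk.injEq, not_or]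
          refine ⟨?_, hy.2 i hi⟩
          rintro ⟨rfl, h'⟩
          exact h h'
      have hRcard : (#R : ℝ) ≤ p * δ * N A := by
        have h1 : #R ≤ #(T.biUnion fun B => ({ω | A ∈ V ω ∧ B ∈ V ω} : Finset Ω)) := by
          apply card_le_card_of_injOn Sigma.fst
          · intro y hy
            simp only [hR, coe_filter, Set.mem_ofPred_eq] at hy
            obtain ⟨B, hB, hBV⟩ := hcov y hy.1 hy.2
            simp only [coe_biUnion, Set.mem_iUnion, coe_filter, Set.mem_ofPred_eq, mem_univ,
              true_and, mem_coe]
            exact ⟨B, hB, hy.2 ▸ hgV _ _ (hMD y hy.1 j hj), hBV⟩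
          · rintro ⟨ω, s⟩ hy ⟨ω', s'⟩ hz (rfl : ω = ω')
            simp only [hR, coe_filter, Set.mem_ofPred_eq] at hy hz
            have := hginj ω _ _ (hMD _ hy.1 j hj) (hMD _ hz.1 j hj) (hy.2.trans hz.2.symm)
            simp only at this
            have : s = s' := by omega
            rw [this]
        have h2 : (#R : ℝ) ≤ ∑ B ∈ T, (#{ω | A ∈ V ω ∧ B ∈ V ω} : ℝ) := by
          exact_mod_cast h1.trans card_biUnion_le
        have h3 : ∑ B ∈ T, (#{ω | A ∈ V ω ∧ B ∈ V ω} : ℝ) ≤ #T * (δ * N A) := by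
          rw [← nsmul_eq_mul]
          exact sum_le_card_nsmul _ _ _ hT
        have h4 : (#T : ℝ) * (δ * N A) ≤ p * (δ * N A) := by
          have := hNnn A
          gcongr
        linarith
      have h5 : (#(M D) : ℝ) ≤ #(M (insert (j, A) D)) + #R := by
        exact_mod_cast (card_le_card hsub).trans (card_union_le _ _)
      rw [hcostI]
      linarith
    exact hnot (hD.2 hins (subset_insert _ _) (mem_insert_self _ _))
  refine ⟨fun j => (M D).image fun x => g x.1 (x.2 + j), fun j hj A hA => ?_,
    fun j _ => hMne.image _, fun j hj => ⟨fun A hA => ?_, fun B hB => ?_⟩⟩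
  · obtain ⟨x, hx, rfl⟩ := mem_image.1 hA
    exact hVF _ (hgV _ _ (hMD x hx j hj))
  · have hA' := mem_image.1 hA
    obtain ⟨x, hx, hxA⟩ := hA'
    have hAF : A ∈ F := hxA ▸ hVF _ (hgV _ _ (hMD x hx j (by omega)))
    apply key j (by omega) A ⟨x, hx, hxA⟩
    · intro B hB
      obtain ⟨hB1, hB2⟩ := mem_filter.1 hB
      obtain ⟨y, hy, rfl⟩ := mem_image.1 hB1
      exact (hsmall A hAF _ (hVF _ (hgV _ _ (hMD y hy _ hj))) hB2).1
    · intro y hy hyA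
      refine ⟨g y.1 (y.2 + (j + 1)), mem_filter.2 ⟨mem_image_of_mem _ hy, ?_⟩,
        hgV _ _ (hMD y hy _ hj)⟩
      rw [← hyA]
      exact hglt _ _ _ (by omega) (hMD y hy _ hj)
  · have hB' := mem_image.1 hB
    obtain ⟨x, hx, hxB⟩ := hB'
    have hBF : B ∈ F := hxB ▸ hVF _ (hgV _ _ (hMD x hx _ hj))
    apply key (j + 1) hj B ⟨x, hx, hxB⟩
    · intro A hA
      obtain ⟨hA1, hA2⟩ := mem_filter.1 hA
      obtain ⟨y, hy, rfl⟩ := mem_image.1 hA1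
      have := (hsmall _ (hVF _ (hgV _ _ (hMD y hy j (by omega)))) B hBF hA2).2
      simpa only [and_comm] using this
    · intro y hy hyB
      refine ⟨g y.1 (y.2 + j), mem_filter.2 ⟨mem_image_of_mem _ hy, ?_⟩,
        hgV _ _ (hMD y hy _ (by omega))⟩
      rw [← hyB]
      exact hglt _ _ _ (by omega) (hMD y hy _ hj)

theorem exists_level_embedding {V S : Type*} [Finite V] [PartialOrder S] [DecidableLT S]
    (G : SimpleGraph V) (hG : G.IsTree) (r : V → ℕ) (hr : ∀ x y, G.Adj x y → r x ≠ r y)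
    (L : ℕ → Finset S) (p : ℕ) (hp : Nat.card V ≤ p)
    (hne : ∀ x, (L (r x)).Nonempty)
    (hup : ∀ x y, r x < r y → ∀ A ∈ L (r x), p ≤ #{B ∈ L (r y) | A < B})
    (hdown : ∀ x y, r x < r y → ∀ B ∈ L (r y), p ≤ #{A ∈ L (r x) | A < B}) :
    ∃ f : V → S, Function.Injective f ∧ (∀ x, f x ∈ L (r x)) ∧
      ∀ x y, G.Adj x y → r x < r y → f x < f y := by
  classical
  have := Fintype.ofFinite V
  induction hn : Nat.card V generalizing V with
  | zero =>
    have := hG.1.nonempty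
    exact absurd hn Nat.card_pos.ne'
  | succ n ih =>
    rcases subsingleton_or_nontrivial V with hV | hV
    · choose f hf using hne
      exact ⟨f, Function.injective_of_subsingleton f, hf, fun x y h =>
        absurd (Subsingleton.elim x y) h.ne⟩
    obtain ⟨v, hv⟩ := hG.exists_vert_degree_one_of_nontrivial
    have hconn := hG.1.induce_compl_singleton_of_degree_eq_one hv
    obtain ⟨u, huv, huniq⟩ := SimpleGraph.degree_eq_one_iff_existsUnique_adj.mp hv
    have hcard : Nat.card ({v}ᶜ : Set V) = n := by
      rw [Nat.card_coe_set_eq, Set.ncard_compl, Set.ncard_singleton, hn]; rfl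
    obtain ⟨f, hinj, hfL, hlt⟩ := ih (V := ({v}ᶜ : Set V)) (G.induce {v}ᶜ)
      ⟨hconn, hG.2.induce _⟩ (fun x => r x) (fun x y h => hr x y h) (by omega) (fun x => hne x)
      (fun x y => hup x y) (fun x y => hdown x y) inferInstance hcard
    have hu : u ∈ ({v}ᶜ : Set V) := by simpa using huv.ne'
    have hext : ∃ B ∈ L (r v), (∀ x, f x ≠ B) ∧ (r u < r v → f ⟨u, hu⟩ < B) ∧
        (r v < r u → B < f ⟨u, hu⟩) := by
      have hbig : ∀ T : Finset S, p ≤ #T → ∃ B ∈ T, ∀ x, f x ≠ B := by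
        intro T hT
        by_contra! h
        have h1 : T ⊆ univ.image f := by
          intro B hB
          obtain ⟨x, hx⟩ := h B hB
          exact mem_image.2 ⟨x, mem_univ _, hx⟩
        have h2 := (card_le_card h1).trans card_image_le
        rw [card_univ, ← Nat.card_eq_fintype_card, hcard] at h2
        omega
      rcases lt_or_gt_of_ne (hr v u huv) with h | h
      · obtain ⟨B, hB, hB'⟩ := hbig _ (hdown v u h _ (hfL ⟨u, hu⟩))
        rw [mem_filter] at hB
        exact ⟨B, hB.1, hB', fun h' => absurd h h'.not_gt, fun _ => hB.2⟩
      · obtain ⟨B, hB, hB'⟩ := hbig _ (hup u v h _ (hfL ⟨u, hu⟩))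
        rw [mem_filter] at hB
        exact ⟨B, hB.1, hB', fun _ => hB.2, fun h' => absurd h h'.not_gt⟩
    obtain ⟨B, hBL, hBf, hB1, hB2⟩ := hext
    refine ⟨fun x => if h : x = v then B else f ⟨x, h⟩, ?_, ?_, ?_⟩
    · intro x y hxy
      by_cases hx : x = v <;> by_cases hy : y = v <;> simp only [hx, hy, dif_pos, dif_neg, not_false_eq_true] at hxy ⊢
      · exact absurd hxy.symm (hBf _)
      · exact absurd hxy (hBf _)
      · exact congrArg Subtype.val (hinj hxy)
    · intro x
      by_cases hx : x = v
      · subst hx; simpa using hBL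
      · simpa [hx] using hfL ⟨x, hx⟩
    · intro x y hadj hxy
      by_cases hx : x = v
      · subst hx
        obtain rfl := huniq y hadj
        have : y ≠ x := hu
        simpa [this] using hB2 hxy
      · by_cases hy : y = v
        · subst hy
          obtain rfl := huniq x hadj.symm
          simpa [hx] using hB1 hxy
        · simpa [hx, hy] using hlt ⟨x, hx⟩ ⟨y, hy⟩ hadj hxy

open Nat in
theorem Numbering.card_prefixed_inter_prefixed {X : Type*} [Fintype X] [DecidableEq X]
    {s t : Finset X} (hst : s ⊆ t) :
    #(Numbering.prefixed s ∩ Numbering.prefixed t)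
      = (#s)! * ((#t - #s)! * (Fintype.card X - #t)!) := by
  set t' : Finset ↑(sᶜ) := t.subtype (· ∈ sᶜ) with ht'
  have hle := card_le_card hst
  have htX := t.card_le_univ
  have hct' : #t' = #t - #s := by
    rw [ht', card_subtype, ← card_sdiff_of_subset hst]
    congr 1
    ext x
    simp
  have hiff : ∀ f : Numbering.prefixed s, (f : Numbering X) ∈ Numbering.prefixed t ↔
      (Numbering.prefixedEquiv s f).2 ∈ Numbering.prefixed t' := by
    intro f
    have hs := Numbering.mem_prefixed.1 f.2
    simp only [Numbering.mem_prefixed, Numbering.IsPrefix]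
    constructor
    · intro h x
      have hx := (hs x).not.1 (mem_compl.1 x.2)
      have hval : ((Numbering.prefixedEquiv s f).2 x : ℕ) = f.1 x - #s := rfl
      rw [hval, hct', ht', mem_subtype, h x]
      omega
    · intro h x
      by_cases hx : x ∈ s
      · have := (hs x).1 hx
        exact ⟨fun _ => by omega, fun _ => hst hx⟩
      · have h1 := h ⟨x, by simpa using hx⟩
        have hval : ((Numbering.prefixedEquiv s f).2 ⟨x, by simpa using hx⟩ : ℕ)
          = f.1 x - #s := rfl
        have hx' := (hs x).not.1 hx
        rw [hval, hct', ht', mem_subtype] at h1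
        simp only at h1
        rw [h1]
        omega
  have e1 : {f // f ∈ Numbering.prefixed s ∩ Numbering.prefixed t} ≃
      {f : Numbering.prefixed s // (f : Numbering X) ∈ Numbering.prefixed t} :=
    (Equiv.subtypeEquivRight (by simp)).trans
      (Equiv.subtypeSubtypeEquivSubtypeInter _ _).symm
  have e2 : {f : Numbering.prefixed s // (f : Numbering X) ∈ Numbering.prefixed t} ≃
      {y : Numbering s × Numbering ↑(sᶜ) // y.2 ∈ Numbering.prefixed t'} :=
    (Numbering.prefixedEquiv s).subtypeEquiv hiff
  have e3 : {y : Numbering s × Numbering ↑(sᶜ) // y.2 ∈ Numbering.prefixed t'} ≃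
      Numbering s × Numbering.prefixed t' :=
    { toFun := fun y => (y.1.1, ⟨y.1.2, y.2⟩)
      invFun := fun z => ⟨(z.1, z.2.1), z.2.2⟩
      left_inv := fun _ => rfl
      right_inv := fun _ => rfl }
  have h := Fintype.card_congr ((e1.trans e2).trans e3)
  have hcs : Fintype.card (Numbering s) = (#s)! := by
    rw [Fintype.card_numbering, Fintype.card_coe]
  have hcompl : Fintype.card ↑(sᶜ) = Fintype.card X - #s := by
    rw [Fintype.card_coe, card_compl]
  rw [Fintype.card_prod, hcs, Fintype.card_coe, Fintype.card_coe, Numbering.card_prefixed, hct',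
    hcompl] at h
  rw [h]
  congr 3
  omega

theorem Nat.le_choose_of_pos_of_lt {m j : ℕ} (h0 : 0 < j) (hj : j < m) : m ≤ m.choose j := by
  obtain ⟨m, rfl⟩ : ∃ m', m = m' + 1 := ⟨m - 1, by omega⟩
  induction m generalizing j with
  | zero => omega
  | succ m ih =>
    obtain ⟨j, rfl⟩ : ∃ j', j = j' + 1 := ⟨j - 1, by omega⟩
    rw [Nat.choose_succ_succ']
    rcases eq_or_lt_of_le (show j + 1 ≤ m + 1 by omega) with h | h
    · have : j = m := by omega
      subst this
      simp
    · have h1 := ih (j := j + 1) (by omega) h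
      have h2 : 0 < (m + 1).choose j := Nat.choose_pos (by omega)
      omega

/-- Among the numberings with `s` as a prefix, at most a proportion `1 / (n - #s)` have a given
nontrivial larger set as a prefix. -/
theorem Numbering.card_inter_mul_le_left {X : Type*} [Fintype X] [DecidableEq X]
    {s t : Finset X} (hst : s ⊂ t) (ht : #t < Fintype.card X) :
    #(Numbering.prefixed s ∩ Numbering.prefixed t) * (Fintype.card X - #s)
      ≤ #(Numbering.prefixed s) := by
  have hlt := card_lt_card hst
  rw [card_prefixed_inter_prefixed hst.1, card_prefixed]
  have h1 := Nat.le_choose_of_pos_of_lt (m := Fintype.card X - #s) (j := #t - #s)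
    (by omega) (by omega)
  have h2 := Nat.choose_mul_factorial_mul_factorial
    (show #t - #s ≤ Fintype.card X - #s by omega)
  rw [show Fintype.card X - #s - (#t - #s) = Fintype.card X - #t by omega] at h2
  rw [← h2, mul_assoc]
  apply Nat.mul_le_mul_left
  calc _ = (Fintype.card X - #s) * ((#t - #s).factorial * (Fintype.card X - #t).factorial) := by
        ring
    _ ≤ _ := by rw [mul_assoc ((Fintype.card X - #s).choose _)]; exact Nat.mul_le_mul_right _ h1

/-- Among the numberings with `t` as a prefix, at most a proportion `1 / #t` have a given
nonempty smaller set as a prefix. -/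
theorem Numbering.card_inter_mul_le_right {X : Type*} [Fintype X] [DecidableEq X]
    {s t : Finset X} (hst : s ⊂ t) (hs : 0 < #s) :
    #(Numbering.prefixed s ∩ Numbering.prefixed t) * #t ≤ #(Numbering.prefixed t) := by
  have hlt := card_lt_card hst
  rw [card_prefixed_inter_prefixed hst.1, card_prefixed]
  have h1 := Nat.le_choose_of_pos_of_lt (m := #t) (j := #s) (by omega) (by omega)
  have h2 := Nat.choose_mul_factorial_mul_factorial (show #s ≤ #t by omega)
  rw [← h2]
  calc _ = #t * ((#s).factorial * (#t - #s).factorial * (Fintype.card X - #t).factorial) := by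
        ring
    _ ≤ (#t).choose #s * ((#s).factorial * (#t - #s).factorial *
          (Fintype.card X - #t).factorial) := Nat.mul_le_mul_right _ h1
    _ = _ := by ring

/-- The sets in `2^[n]` whose size is within `n / 4` of `n / 2`. -/
def middleSets (n : ℕ) (𝓕 : Finset (Finset (Fin n))) : Finset (Finset (Fin n)) :=
  𝓕.filter fun A => n ≤ 4 * #A ∧ 4 * #A ≤ 3 * n

theorem Nat.two_pow_mul_choose_le {n i j : ℕ} (h : 3 * (i + j) ≤ n + 1) :
    2 ^ j * n.choose i ≤ n.choose (i + j) := by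
  induction j with
  | zero => simp
  | succ j ih =>
    have h1 := ih (by omega)
    have h2 := Nat.choose_succ_right_eq n (i + j)
    have h3 : 2 * (i + j + 1) ≤ n - (i + j) := by omega
    have h4 : 2 * n.choose (i + j) ≤ n.choose (i + j + 1) := by
      have : 2 * n.choose (i + j) * (i + j + 1) ≤ n.choose (i + j + 1) * (i + j + 1) := by
        rw [h2]
        calc _ = n.choose (i + j) * (2 * (i + j + 1)) := by ring
          _ ≤ _ := Nat.mul_le_mul_left _ h3
      exact Nat.le_of_mul_le_mul_right this (by omega)
    calc 2 ^ (j + 1) * n.choose i = 2 * (2 ^ j * n.choose i) := by ring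
      _ ≤ 2 * n.choose (i + j) := by omega
      _ ≤ _ := h4

theorem Nat.sq_mul_choose_le_of_lt_quarter {n i : ℕ} (h : 4 * i < n) :
    n ^ 2 * n.choose i ≤ 576 * n.choose (n / 2) := by
  have hsq : ∀ j : ℕ, (j + 1) ^ 2 ≤ 4 * 2 ^ j := by
    intro j
    induction j with
    | zero => norm_num
    | succ j ih =>
      rcases j with _ | _ | j
      · norm_num
      · norm_num
      · have h2 : 2 ^ (j + 1 + 1 + 1) = 2 * 2 ^ (j + 1 + 1) := by ring
        rw [h2]
        generalize 2 ^ (j + 1 + 1) = x at ih ⊢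
        nlinarith [Nat.zero_le (j * j)]
  have h1 := Nat.two_pow_mul_choose_le (n := n) (i := i) (j := n / 12) (by omega)
  have h2 := (h1.trans (Nat.choose_le_middle _ _))
  have h3 : n ^ 2 ≤ 576 * 2 ^ (n / 12) := by
    have h4 : n ≤ 12 * (n / 12 + 1) := by omega
    have := hsq (n / 12)
    calc n ^ 2 ≤ (12 * (n / 12 + 1)) ^ 2 := Nat.pow_le_pow_left h4 2
      _ = 144 * (n / 12 + 1) ^ 2 := by ring
      _ ≤ 144 * (4 * 2 ^ (n / 12)) := by omega
      _ = _ := by ring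
  calc n ^ 2 * n.choose i ≤ 576 * 2 ^ (n / 12) * n.choose i := Nat.mul_le_mul_right _ h3
    _ = 576 * (2 ^ (n / 12) * n.choose i) := by ring
    _ ≤ _ := Nat.mul_le_mul_left _ h2

theorem mul_card_sdiff_middleSets_le {n : ℕ} (hn : 1 ≤ n) (𝓕 : Finset (Finset (Fin n))) :
    n * #(𝓕 \ middleSets n 𝓕) ≤ 1152 * n.choose (n / 2) := by
  have h1 : n ^ 2 * #(𝓕 \ middleSets n 𝓕) ≤ (n + 1) * (576 * n.choose (n / 2)) := by
    have hmaps : ∀ A ∈ 𝓕 \ middleSets n 𝓕, #A ∈ range (n + 1) := by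
      intro A _
      have := A.card_le_univ
      simp at this ⊢
      omega
    rw [card_eq_sum_card_fiberwise hmaps, mul_sum]
    calc _ ≤ ∑ _i ∈ range (n + 1), 576 * n.choose (n / 2) := ?_
      _ = _ := by simp
    apply sum_le_sum
    intro i hi
    rw [mem_range] at hi
    by_cases hmid : n ≤ 4 * i ∧ 4 * i ≤ 3 * n
    · have : ({A ∈ 𝓕 \ middleSets n 𝓕 | #A = i} : Finset _) = ∅ := by
        apply filter_eq_empty_iff.2
        rintro A hA rfl
        rw [mem_sdiff, middleSets, mem_filter] at hA
        exact hA.2 ⟨hA.1, hmid⟩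
      rw [this]
      simp
    · have h2 : #({A ∈ 𝓕 \ middleSets n 𝓕 | #A = i} : Finset _) ≤ n.choose i := by
        have : ({A ∈ 𝓕 \ middleSets n 𝓕 | #A = i} : Finset _) ⊆ powersetCard i univ := by
          intro A hA
          simpa [mem_powersetCard] using (mem_filter.1 hA).2
        simpa using card_le_card this
      refine (Nat.mul_le_mul_left _ h2).trans ?_
      rcases (by omega : 4 * i < n ∨ 4 * (n - i) < n) with h | h
      · exact Nat.sq_mul_choose_le_of_lt_quarter h
      · rw [← Nat.choose_symm (by omega : i ≤ n)]
        exact Nat.sq_mul_choose_le_of_lt_quarter h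
  have h2 : n * (n * #(𝓕 \ middleSets n 𝓕)) ≤ n * (1152 * n.choose (n / 2)) := by
    calc _ = n ^ 2 * #(𝓕 \ middleSets n 𝓕) := by ring
      _ ≤ _ := h1
      _ ≤ (2 * n) * (576 * n.choose (n / 2)) := Nat.mul_le_mul_right _ (by omega)
      _ = _ := by ring
  exact Nat.le_of_mul_le_mul_left h2 hn

/-- The binomial coefficients near the middle are almost maximal. -/
theorem choose_half_add_ge {n : ℕ} (hn : 1 ≤ n) (i : ℕ) :
    (n.choose (n / 2) : ℝ) * (1 - 2 * i ^ 2 / n) ≤ n.choose (n / 2 + i) := by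
  have hn' : (0 : ℝ) < n := by exact_mod_cast hn
  induction i with
  | zero => simp
  | succ i ih =>
    set j := n / 2 + i with hj
    have hmid : (n.choose j : ℝ) ≤ n.choose (n / 2) := by
      exact_mod_cast Nat.choose_le_middle j n
    have hstep : (n.choose j : ℝ) - n.choose (j + 1) ≤ (4 * i + 2) / n * n.choose (n / 2) := by
      by_cases hjn : j ≤ n
      · have h1 := Nat.choose_succ_right_eq n j
        have h2 : (n.choose (j + 1) : ℝ) * (j + 1) = n.choose j * (n - j) := by
          have := congrArg (Nat.cast (R := ℝ)) h1
          push_cast [Nat.cast_sub hjn] at this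
          exact this
        have h3 : (2 * j : ℝ) ≤ n + 2 * i := by
          have : 2 * j ≤ n + 2 * i := by omega
          exact_mod_cast this
        have h4 : (n : ℝ) ≤ 2 * (j + 1) := by
          have : n ≤ 2 * (j + 1) := by omega
          exact_mod_cast this
        have h5 : (0 : ℝ) ≤ n.choose j := by positivity
        have h6 : ((n.choose j : ℝ) - n.choose (j + 1)) * (j + 1) ≤ n.choose j * (2 * i + 1) := by
          nlinarith
        have h7 : ((n.choose j : ℝ) - n.choose (j + 1)) ≤ n.choose j * (2 * i + 1) / (j + 1) := by
          rwa [le_div_iff₀ (by positivity)]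
        refine h7.trans ?_
        rw [div_mul_eq_mul_div, div_le_div_iff₀ (by positivity) hn']
        have h8 : (0 : ℝ) ≤ i := by positivity
        calc (n.choose j : ℝ) * (2 * i + 1) * n ≤ n.choose (n / 2) * (2 * i + 1) * (2 * (j + 1)) := by
              gcongr
          _ = _ := by ring
      · rw [Nat.choose_eq_zero_of_lt (by omega : n < j)]
        have : (0 : ℝ) ≤ (4 * i + 2) / n * n.choose (n / 2) := by positivity
        have : (0 : ℝ) ≤ n.choose (j + 1) := by positivity
        push_cast
        linarith
    have : (n.choose (n / 2) : ℝ) * (1 - 2 * ((i + 1 : ℕ) : ℝ) ^ 2 / n) =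
        n.choose (n / 2) * (1 - 2 * i ^ 2 / n) - (4 * i + 2) / n * n.choose (n / 2) := by
      push_cast
      field_simp
      ring
    rw [this, ← add_assoc, ← hj]
    linarith

/-- If adjacent levels branch, then so do any two levels. -/
theorem branching_of_adjacent_levels {S : Type*} [PartialOrder S] [DecidableLT S]
    (L : ℕ → Finset S) {k p : ℕ} (hp : 0 < p)
    (hL : ∀ j, j + 1 < k → (∀ A ∈ L j, p ≤ #{B ∈ L (j + 1) | A < B}) ∧
      ∀ B ∈ L (j + 1), p ≤ #{A ∈ L j | A < B}) {i j : ℕ} (hij : i < j) (hj : j < k) :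
    (∀ A ∈ L i, p ≤ #{B ∈ L j | A < B}) ∧ ∀ B ∈ L j, p ≤ #{A ∈ L i | A < B} := by
  induction j, hij using Nat.le_induction with
  | base => exact hL i hj
  | succ j hij ih =>
    obtain ⟨h1, h2⟩ := ih (by omega)
    obtain ⟨h3, h4⟩ := hL j hj
    constructor
    · intro A hA
      obtain ⟨B, hB⟩ := card_pos.1 (hp.trans_le (h1 A hA))
      rw [mem_filter] at hB
      refine (h3 B hB.1).trans (card_le_card fun C hC => ?_)
      rw [mem_filter] at hC ⊢
      exact ⟨hC.1, hB.2.trans hC.2⟩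
    · intro C hC
      obtain ⟨B, hB⟩ := card_pos.1 (hp.trans_le (h4 C hC))
      rw [mem_filter] at hB
      refine (h2 B hB.1).trans (card_le_card fun A hA => ?_)
      rw [mem_filter] at hA ⊢
      exact ⟨hA.1, hA.2.trans hB.2⟩

/-- A finite poset of height `h` has a strictly monotone map to `{0, …, h - 1}`. -/
theorem HasHeight.exists_rank {α : Type*} [Fintype α] [PartialOrder α] {h : ℕ}
    (hh : HasHeight α h) : ∃ r : α → ℕ, (∀ x, r x < h) ∧ ∀ x y, x < y → r x < r y := by
  classical
  set below : α → Finset (Finset α) := fun x =>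
    univ.filter fun c => IsChain (· ≤ ·) (c : Set α) ∧ ∀ y ∈ c, y < x with hbelow
  have hext : ∀ x, ∃ c : Finset α, IsChain (· ≤ ·) (c : Set α) ∧ (∀ y ∈ c, y ≤ x) ∧
      #c = (below x).sup card + 1 := by
    intro x
    have hne : (below x).Nonempty := ⟨∅, by simp [hbelow]⟩
    obtain ⟨c, hc, hcard⟩ := exists_mem_eq_sup _ hne card
    simp only [hbelow, mem_filter, mem_univ, true_and] at hc
    refine ⟨insert x c, ?_, ?_, ?_⟩
    · rw [coe_insert]
      exact hc.1.insert fun y hy _ => Or.inr (hc.2 y hy).le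
    · intro y hy
      rcases mem_insert.1 hy with rfl | hy
      · exact le_rfl
      · exact (hc.2 y hy).le
    · rw [hcard, card_insert_of_notMem fun hx => (hc.2 x hx).false]
  refine ⟨fun x => (below x).sup card, fun x => ?_, fun x y hxy => ?_⟩
  · obtain ⟨c, hc, -, hcard⟩ := hext x
    have := hh.2 c hc
    show (below x).sup card < h
    omega
  · obtain ⟨c, hc, hcx, hcard⟩ := hext x
    have : #c ≤ (below y).sup card := le_sup (f := card) (by
      simp only [hbelow, mem_filter, mem_univ, true_and]
      exact ⟨hc, fun z hz => (hcx z hz).trans_lt hxy⟩)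
    show (below x).sup card < (below y).sup card
    omega

theorem PFree.mono {α : Type*} [Preorder α] {n : ℕ} {𝓕 𝓖 : Finset (Finset (Fin n))}
    (h : PFree α 𝓕) (hsub : 𝓖 ⊆ 𝓕) : PFree α 𝓖 :=
  fun ⟨f, hinj, hmem, hle⟩ => h ⟨f, hinj, fun a => hsub (hmem a), hle⟩

/-- A family with `h` levels, each branching to the others, contains every tree poset of
height `h`. -/
theorem not_pfree_of_levels {α : Type*} [Fintype α] [PartialOrder α] {h : ℕ}
    (hh : HasHeight α h) (htree : (SimpleGraph.hasse α).IsTree) {n : ℕ}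
    {𝓕 : Finset (Finset (Fin n))} (L : ℕ → Finset (Finset (Fin n))) (hsub : ∀ j < h, L j ⊆ 𝓕)
    (hne : ∀ j < h, (L j).Nonempty)
    (hL : ∀ j, j + 1 < h → (∀ A ∈ L j, Fintype.card α ≤ #{B ∈ L (j + 1) | A < B}) ∧
      ∀ B ∈ L (j + 1), Fintype.card α ≤ #{A ∈ L j | A < B}) : ¬ PFree α 𝓕 := by
  classical
  obtain ⟨r, hrh, hr⟩ := hh.exists_rank
  have := htree.1.nonempty
  have hp : 0 < Fintype.card α := Fintype.card_pos
  obtain ⟨f, hinj, hfL, hf⟩ := exists_level_embedding (SimpleGraph.hasse α) htree r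
    (fun x y hxy => by
      rcases hxy with hxy | hxy
      · exact (hr _ _ hxy.lt).ne
      · exact (hr _ _ hxy.lt).ne')
    L (Fintype.card α) Nat.card_eq_fintype_card.le (fun x => hne _ (hrh x))
    (fun x y hxy => (branching_of_adjacent_levels L hp hL hxy (hrh y)).1)
    (fun x y hxy => (branching_of_adjacent_levels L hp hL hxy (hrh y)).2)
  let : LocallyFiniteOrder α := Fintype.toLocallyFiniteOrder
  have hmono : Monotone f := (monotone_iff_forall_covBy f).2 fun x y hxy =>
    (hf x y (Or.inl hxy) (hr _ _ hxy.lt)).le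
  exact fun hfree => hfree ⟨f, hinj, fun x => hsub _ (hrh x) (hfL x), fun a b hab => hmono hab⟩

/-- The members of `𝓕` in the maximal chain of `2^[n]` given by a numbering. -/
def prefixesIn {n : ℕ} (𝓕 : Finset (Finset (Fin n))) (ω : Numbering (Fin n)) :
    Finset (Finset (Fin n)) :=
  𝓕.filter fun A => Numbering.IsPrefix ω A

theorem isChain_prefixesIn {n : ℕ} (𝓕 : Finset (Finset (Fin n))) (ω : Numbering (Fin n)) :
    IsChain (· ≤ ·) (prefixesIn 𝓕 ω : Set (Finset (Fin n))) := by
  intro A hA B hB _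
  have hA' := (mem_filter.1 hA).2
  have hB' := (mem_filter.1 hB).2
  rcases le_total #A #B with h | h
  · exact Or.inl (hA'.subset_of_card_le_card hB' h)
  · exact Or.inr (hB'.subset_of_card_le_card hA' h)

/-- The LYM-type lower bound for the average number of members of `𝓕` in a maximal chain. -/
theorem card_mul_factorial_le {n : ℕ} (𝓕 : Finset (Finset (Fin n))) :
    #𝓕 * n.factorial ≤ n.choose (n / 2) * ∑ ω, #(prefixesIn 𝓕 ω) := by
  have hsum : ∑ ω, #(prefixesIn 𝓕 ω) = ∑ A ∈ 𝓕, #(Numbering.prefixed A) :=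
    (sum_card_bipartiteAbove_eq_sum_card_bipartiteBelow (s := 𝓕)
      (t := (univ : Finset (Numbering (Fin n)))) fun A ω => Numbering.IsPrefix ω A).symm
  rw [hsum, mul_sum, ← smul_eq_mul]
  apply card_nsmul_le_sum
  intro A _
  have hA : #A ≤ n := by simpa using A.card_le_univ
  rw [Numbering.card_prefixed, Fintype.card_fin, ← Nat.choose_mul_factorial_mul_factorial hA,
    mul_assoc]
  exact Nat.mul_le_mul_right _ (Nat.choose_le_middle _ _)

theorem sum_card_prefixesIn_le_of_pfree {α : Type*} [Fintype α] [PartialOrder α] {h : ℕ}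
    (hh : HasHeight α h) (htree : (SimpleGraph.hasse α).IsTree) {n : ℕ} (hn : 1 ≤ n)
    {𝓕 : Finset (Finset (Fin n))} (hmid : ∀ A ∈ 𝓕, n ≤ 4 * #A ∧ 4 * #A ≤ 3 * n)
    (hfree : PFree α 𝓕) :
    ∑ ω, (#(prefixesIn 𝓕 ω) : ℝ) ≤ ((h : ℝ) - 1) * n.factorial
      + h * Fintype.card α * (4 / n) * ∑ ω, (#(prefixesIn 𝓕 ω) : ℝ) := by
  classical
  by_contra! hbig
  have hn' : (0 : ℝ) < n := by exact_mod_cast hn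
  have hfrac : ∀ a b m : ℕ, n ≤ 4 * m → a * m ≤ b → (a : ℝ) ≤ 4 / n * b := by
    intro a b m hm hab
    have h1 : a * n ≤ 4 * b := by nlinarith
    have h2 : (a : ℝ) * n ≤ 4 * b := by exact_mod_cast h1
    rw [div_mul_eq_mul_div, le_div_iff₀ hn']
    exact h2
  have hthrough : ∀ A ∈ 𝓕, ({ω | A ∈ prefixesIn 𝓕 ω} : Finset (Numbering (Fin n)))
      = Numbering.prefixed A := by
    intro A hA; ext ω; simp [prefixesIn, hA]
  obtain ⟨L, hsub, hne, hL⟩ := exists_branching_levels 𝓕 (prefixesIn 𝓕)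
    (fun ω => filter_subset _ _) (isChain_prefixesIn 𝓕) h (Fintype.card α) (4 / n) (by positivity)
    (fun A hA B hB hAB => by
      have hinter : ({ω | A ∈ prefixesIn 𝓕 ω ∧ B ∈ prefixesIn 𝓕 ω} :
          Finset (Numbering (Fin n))) = Numbering.prefixed A ∩ Numbering.prefixed B := by
        rw [filter_and, hthrough A hA, hthrough B hB]
      rw [hinter, hthrough A hA, hthrough B hB]
      have hA' := hmid A hA
      have hB' := hmid B hB
      constructor
      · refine hfrac _ _ (n - #A) (by omega) ?_
        simpa using Numbering.card_inter_mul_le_left hAB (by simp; omega)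
      · exact hfrac _ _ #B hB'.1 (Numbering.card_inter_mul_le_right hAB (by omega)))
    (by simpa [Fintype.card_numbering] using hbig)
  exact not_pfree_of_levels hh htree L hsub hne hL hfree

/-- The `m` layers of `2^[n]` starting from the middle one contain no poset of height above `m`. -/
theorem pfree_middle_layers {α : Type*} [PartialOrder α] {h : ℕ} (hh : HasHeight α h) {m : ℕ}
    (hm : m < h) (n : ℕ) :
    PFree α ({A | n / 2 ≤ #A ∧ #A < n / 2 + m} : Finset (Finset (Fin n))) := by
  rintro ⟨f, hinj, hmem, hle⟩
  obtain ⟨c, hc, hcard⟩ := hh.1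
  have hmaps : ∀ a ∈ c, #(f a) ∈ Ico (n / 2) (n / 2 + m) := fun a _ => by
    simpa using hmem a
  obtain ⟨a, ha, b, hb, hab, heq⟩ :=
    exists_ne_map_eq_of_card_lt_of_maps_to (by simp; omega) hmaps
  rcases hc ha hb hab with h1 | h1
  · exact hab (hinj (eq_of_subset_of_card_le (hle _ _ h1) heq.ge))
  · exact hab (hinj (eq_of_subset_of_card_le (hle _ _ h1) heq.le).symm)

theorem card_middle_layers_ge {n : ℕ} (hn : 1 ≤ n) (m : ℕ) :
    (m : ℝ) * n.choose (n / 2) * (1 - 2 * m ^ 2 / n)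
      ≤ #({A | n / 2 ≤ #A ∧ #A < n / 2 + m} : Finset (Finset (Fin n))) := by
  have hcard : #({A | n / 2 ≤ #A ∧ #A < n / 2 + m} : Finset (Finset (Fin n)))
      = ∑ i ∈ range m, n.choose (n / 2 + i) := by
    have hmaps : ∀ A ∈ ({A | n / 2 ≤ #A ∧ #A < n / 2 + m} : Finset (Finset (Fin n))),
        #A ∈ Ico (n / 2) (n / 2 + m) := fun A hA => by simpa using hA
    rw [card_eq_sum_card_fiberwise hmaps, sum_Ico_eq_sum_range, Nat.add_sub_cancel_left]
    refine sum_congr rfl fun i hi => ?_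
    rw [mem_range] at hi
    have : ({A ∈ ({A | n / 2 ≤ #A ∧ #A < n / 2 + m} : Finset (Finset (Fin n))) |
        #A = n / 2 + i} : Finset _) = powersetCard (n / 2 + i) univ := by
      ext A
      simp only [mem_filter, mem_univ, true_and, mem_powersetCard, subset_univ]
      omega
    rw [this]
    simp
  rw [hcard]
  push_cast
  have : (m : ℝ) * n.choose (n / 2) * (1 - 2 * m ^ 2 / n)
      = #(range m) • ((n.choose (n / 2) : ℝ) * (1 - 2 * m ^ 2 / n)) := by
    simp [mul_assoc]
  rw [this]
  apply card_nsmul_le_sum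
  intro i hi
  refine le_trans ?_ (choose_half_add_ge hn i)
  have : (i : ℝ) ≤ m := by exact_mod_cast (mem_range.1 hi).le
  gcongr

theorem HasHeight.subsingleton_of_le_one {α : Type*} [PartialOrder α] {h : ℕ}
    (hh : HasHeight α h) (htree : (SimpleGraph.hasse α).IsTree) (h1 : h ≤ 1) :
    Subsingleton α := by
  classical
  have hlt : ∀ x y : α, ¬ x < y := by
    intro x y hxy
    have := hh.2 {x, y} (by
      rw [coe_pair]
      exact IsChain.pair hxy.le)
    rw [card_pair hxy.ne] at this
    omega
  by_contra hns
  rw [not_subsingleton_iff_nontrivial] at hns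
  obtain ⟨x⟩ := htree.1.nonempty
  obtain ⟨y, hy | hy⟩ := htree.1.preconnected.exists_adj_of_nontrivial x
  · exact hlt _ _ hy.lt
  · exact hlt _ _ hy.lt

/-- Upper bound for `PFree` families consisting of sets whose size is within `n / 4` of `n / 2`. -/
theorem card_le_of_pfree_of_middle {α : Type*} [Fintype α] [PartialOrder α] {h : ℕ}
    (hh : HasHeight α h) (htree : (SimpleGraph.hasse α).IsTree) {n : ℕ} (hn : 1 ≤ n)
    {𝓕 : Finset (Finset (Fin n))} (hmid : ∀ A ∈ 𝓕, n ≤ 4 * #A ∧ 4 * #A ≤ 3 * n)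
    (hfree : PFree α 𝓕) {c : ℝ}
    (hc : c = 4 * h * Fintype.card α) (hcn : 2 * c ≤ n) :
    (#𝓕 : ℝ) ≤ ((h : ℝ) - 1) * n.choose (n / 2) * (1 + 2 * c / n) := by
  have hn' : (0 : ℝ) < n := by exact_mod_cast hn
  have hfac : (0 : ℝ) < n.factorial := by exact_mod_cast n.factorial_pos
  have hsum := sum_card_prefixesIn_le_of_pfree hh htree hn hmid hfree
  have hlym : (#𝓕 : ℝ) * n.factorial ≤ n.choose (n / 2) * ∑ ω, (#(prefixesIn 𝓕 ω) : ℝ) := by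
    exact_mod_cast card_mul_factorial_le 𝓕
  have hW0 : 0 ≤ ∑ ω, (#(prefixesIn 𝓕 ω) : ℝ) := sum_nonneg fun _ _ => Nat.cast_nonneg _
  generalize ∑ ω, (#(prefixesIn 𝓕 ω) : ℝ) = W at hsum hlym hW0
  have hx : (h : ℝ) * Fintype.card α * (4 / n) = c / n := by rw [hc]; ring
  have hx0 : 0 ≤ c / n := by rw [hc]; positivity
  have hx1 : c / n ≤ 1 / 2 := by rw [div_le_iff₀ hn']; linarith
  rw [hx] at hsum
  rw [mul_div_assoc]
  generalize c / n = x at hsum hx0 hx1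
  have hWx : W * (1 - x) ≤ ((h : ℝ) - 1) * n.factorial := by linarith
  have hWle : W ≤ ((h : ℝ) - 1) * n.factorial * (1 + 2 * x) := by
    have h5 : 1 ≤ (1 - x) * (1 + 2 * x) := by nlinarith
    calc W ≤ W * ((1 - x) * (1 + 2 * x)) := le_mul_of_one_le_right hW0 h5
      _ = W * (1 - x) * (1 + 2 * x) := by ring
      _ ≤ ((h : ℝ) - 1) * n.factorial * (1 + 2 * x) := by gcongr
  refine le_of_mul_le_mul_right ?_ hfac
  calc (#𝓕 : ℝ) * n.factorial ≤ n.choose (n / 2) * W := hlym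
    _ ≤ n.choose (n / 2) * (((h : ℝ) - 1) * n.factorial * (1 + 2 * x)) := by gcongr
    _ = _ := by ring

/-- Upper bound for `PFree` families when the poset has height at least two. -/
theorem card_le_of_pfree {α : Type*} [Fintype α] [PartialOrder α] {h : ℕ}
    (hh : HasHeight α h) (htree : (SimpleGraph.hasse α).IsTree) (h2 : 2 ≤ h) {n : ℕ}
    (hn : 1 ≤ n) {c C : ℝ} (hc : c = 4 * h * Fintype.card α) (hC1 : 2 * c + 1152 ≤ C)
    (hC2 : 8 * c ^ 2 ≤ C) {𝓕 : Finset (Finset (Fin n))} (hfree : PFree α 𝓕) :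
    (#𝓕 : ℝ) ≤ ((h : ℝ) - 1) * n.choose (n / 2) * (1 + C / n) := by
  have hn1 : (1 : ℝ) ≤ n := by exact_mod_cast hn
  have hn' : (0 : ℝ) < n := by linarith
  have hh1 : (1 : ℝ) ≤ (h : ℝ) - 1 := by
    have : (2 : ℝ) ≤ h := by exact_mod_cast h2
    linarith
  have hc0 : 0 ≤ c := by rw [hc]; positivity
  have hM : (0 : ℝ) < n.choose (n / 2) := by exact_mod_cast Nat.choose_pos (Nat.div_le_self n 2)
  by_cases hsmall : (n : ℝ) < 2 * c
  · have h1 : #𝓕 ≤ (n + 1) * n.choose (n / 2) := by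
      have : #𝓕 ≤ 2 ^ n := by simpa using card_le_univ 𝓕
      refine this.trans ?_
      rw [← Nat.sum_range_choose n]
      simpa using sum_le_card_nsmul (range (n + 1)) n.choose (n.choose (n / 2)) fun i _ =>
        Nat.choose_le_middle i n
    have h3 : (#𝓕 : ℝ) ≤ (n + 1) * n.choose (n / 2) := by exact_mod_cast h1
    have h4 : (n : ℝ) ≤ C / n := by
      rw [le_div_iff₀ hn']
      nlinarith
    calc (#𝓕 : ℝ) ≤ (n + 1) * n.choose (n / 2) := h3
      _ ≤ (1 + C / n) * (((h : ℝ) - 1) * n.choose (n / 2)) := by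
          refine mul_le_mul (by linarith) ?_ hM.le (by linarith)
          exact le_mul_of_one_le_left hM.le hh1
      _ = _ := by ring
  · push Not at hsmall
    set 𝓜 := middleSets n 𝓕 with h𝓜
    have hsub : 𝓜 ⊆ 𝓕 := filter_subset _ _
    have hmid := card_le_of_pfree_of_middle hh htree hn (𝓕 := 𝓜)
      (fun A hA => (mem_filter.1 hA).2) (hfree.mono hsub) hc hsmall
    have hrest : (#(𝓕 \ 𝓜) : ℝ) ≤ ((h : ℝ) - 1) * n.choose (n / 2) * (1152 / n) := by
      have h3 : (n : ℝ) * #(𝓕 \ 𝓜) ≤ 1152 * n.choose (n / 2) := by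
        exact_mod_cast mul_card_sdiff_middleSets_le hn 𝓕
      have h4 : (#(𝓕 \ 𝓜) : ℝ) ≤ n.choose (n / 2) * (1152 / n) := by
        rw [mul_div_assoc', le_div_iff₀ hn']
        linarith
      refine h4.trans ?_
      gcongr
      nlinarith
    have hsplit : (#𝓕 : ℝ) = #(𝓕 \ 𝓜) + #𝓜 := by
      exact_mod_cast (card_sdiff_add_card_eq_card hsub).symm
    calc (#𝓕 : ℝ) ≤ ((h : ℝ) - 1) * n.choose (n / 2) * (1 + (2 * c + 1152) / n) := by
          rw [hsplit, add_div]
          linarith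
      _ ≤ _ := by gcongr

/-- If the Hasse diagram of a finite poset `P` of height `h` is a tree, then
`ex(P,n) = (h-1)·C(n,⌊n/2⌋)·(1 + O(1/n))`: there is a constant `C` such that every
`P`-free family has size at most `(h-1)·C(n,⌊n/2⌋)·(1 + C/n)` and some `P`-free family
has size at least `(h-1)·C(n,⌊n/2⌋)·(1 - C/n)`. -/
theorem stmt_9 (α : Type) [Fintype α] [PartialOrder α] (h : ℕ)
    (hh : HasHeight α h) (htree : (SimpleGraph.hasse α).IsTree) :
    ∃ C : ℝ, 0 < C ∧ ∀ n : ℕ, 1 ≤ n →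
      (∀ 𝓕 : Finset (Finset (Fin n)), PFree α 𝓕 →
        (𝓕.card : ℝ) ≤ ((h : ℝ) - 1) * (n.choose (n / 2) : ℝ) * (1 + C / n)) ∧
      (∃ 𝓕 : Finset (Finset (Fin n)), PFree α 𝓕 ∧
        ((h : ℝ) - 1) * (n.choose (n / 2) : ℝ) * (1 - C / n) ≤ (𝓕.card : ℝ)) := by
  have hh1 : 1 ≤ h := by
    obtain ⟨x⟩ := htree.1.nonempty
    simpa using hh.2 {x} (by simp)
  set c : ℝ := 4 * h * Fintype.card α with hc
  have hc0 : 0 ≤ c := by positivity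
  refine ⟨8 * c ^ 2 + 2 * c + 1152 + 2 * h ^ 2, by positivity, fun n hn => ⟨fun 𝓕 hfree => ?_, ?_⟩⟩
  · rcases (by omega : h = 1 ∨ 2 ≤ h) with rfl | h2
    · have := hh.subsingleton_of_le_one htree le_rfl
      have hempty : 𝓕 = ∅ := by
        refine eq_empty_of_forall_notMem fun A hA => hfree ⟨fun _ => A, ?_, fun _ => hA, ?_⟩
        · exact Function.injective_of_subsingleton _
        · exact fun _ _ _ => le_rfl
      simp [hempty]
    · exact card_le_of_pfree hh htree h2 hn hc (by nlinarith [sq_nonneg c, sq_nonneg (h : ℝ)])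
        (by nlinarith [sq_nonneg (h : ℝ)]) hfree
  · refine ⟨_, pfree_middle_layers hh (Nat.sub_lt hh1 one_pos) n, ?_⟩
    refine le_trans ?_ (card_middle_layers_ge hn (h - 1))
    rw [Nat.cast_sub hh1, Nat.cast_one]
    have h1 : (0 : ℝ) ≤ (h : ℝ) - 1 := by
      have : (1 : ℝ) ≤ h := by exact_mod_cast hh1
      linarith
    gcongr
    nlinarith [sq_nonneg c]
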